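/- Let c^V(n) denote the number of compositions (c_1,…,c_t) of n such that c_{2i-1} = 1 for every odd index 2i−1 ≤ t and c_{2i} is odd and at least 3 for every even index 2i ≤ t. Then for every integer j ≥ 1, c^V(2j) = c^V(2j+1) = f_{j-1}, where f denotes the Fibonacci numbers. -/

import Mathlib

/-- A composition of `n`: a list of positive integers summing to `n`. -/
def IsComposition (n : ℕ) (l : List ℕ) : Prop :=
  (∀ x ∈ l, 0 < x) ∧ l.sum = n

/-- The list alternates between `1` and odd numbers that are at least `3`, beginning with `1`. -/
def AlternatesOneOdd : List ℕ → Prop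
  | [] => True
  | [a] => a = 1
  | a :: b :: l => a = 1 ∧ Odd b ∧ 3 ≤ b ∧ AlternatesOneOdd l

theorem AlternatesOneOdd.pos : ∀ {l : List ℕ}, AlternatesOneOdd l → ∀ x ∈ l, 0 < x
  | [], _ => by simp
  | [a], h => by
    simp only [AlternatesOneOdd] at h
    simp [h]
  | a :: b :: l, h => by
    obtain ⟨ha, -, hb, hl⟩ := h
    have := hl.pos
    simp only [List.mem_cons, forall_eq_or_imp]
    exact ⟨by omega, by omega, this⟩

theorem alternatesOneOdd_iff_getD : ∀ l : List ℕ, AlternatesOneOdd l ↔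
    (∀ i : ℕ, 2 * i < l.length → l.getD (2 * i) 0 = 1) ∧
      (∀ i : ℕ, 2 * i + 1 < l.length →
        Odd (l.getD (2 * i + 1) 0) ∧ 3 ≤ l.getD (2 * i + 1) 0)
  | [] => by simp [AlternatesOneOdd]
  | [a] => by
    simp only [AlternatesOneOdd, List.length_singleton]
    constructor
    · rintro rfl
      refine ⟨fun i hi => ?_, fun i hi => by omega⟩
      obtain rfl : i = 0 := by omega
      simp
    · rintro ⟨h, -⟩
      simpa using h 0 (by simp)
  | a :: b :: l => by
    rw [AlternatesOneOdd, alternatesOneOdd_iff_getD l]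
    constructor
    · rintro ⟨ha, hodd, hb, heven, hl⟩
      constructor
      · rintro (_ | i) hi
        · simpa using ha
        · simpa [Nat.mul_succ] using heven i (by simp at hi; omega)
      · rintro (_ | i) hi
        · simpa using ⟨hodd, hb⟩
        · simpa [Nat.mul_succ] using hl i (by simp at hi; omega)
    · rintro ⟨h₁, h₂⟩
      have hb := h₂ 0 (by simp)
      refine ⟨by simpa using h₁ 0 (by simp), by simpa using hb.1, by simpa using hb.2,
        fun i hi => ?_, fun i hi => ?_⟩
      · simpa [Nat.mul_succ] using h₁ (i + 1) (by simp; omega)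
      · simpa [Nat.mul_succ] using h₂ (i + 1) (by simp; omega)

/-- The compositions of `n` that alternate between `1` and odd parts at least `3`. -/
def alternatingCompositions (n : ℕ) : Set (List ℕ) :=
  {l | AlternatesOneOdd l ∧ l.sum = n}

theorem alternatingCompositions_add_four (n : ℕ) :
    alternatingCompositions (n + 4) =
      (fun l => 1 :: 3 :: l) '' alternatingCompositions n ∪
        (fun l => l.modify 1 (· + 2)) '' alternatingCompositions (n + 2) := by
  ext l
  constructor
  · rintro ⟨hl, hsum⟩
    match l, hl, hsum with
    | [], _, hsum => simp at hsum
    | [a], hl, hsum =>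
      simp only [AlternatesOneOdd] at hl
      simp at hsum
      omega
    | a :: b :: l, ⟨ha, hodd, hb, hl⟩, hsum =>
      simp only [List.sum_cons] at hsum
      subst ha
      obtain rfl | hb3 := eq_or_ne b 3
      · exact Or.inl ⟨l, ⟨hl, by omega⟩, rfl⟩
      · obtain ⟨k, rfl⟩ := hodd
        refine Or.inr ⟨1 :: (2 * k - 1) :: l,
          ⟨⟨rfl, ⟨k - 1, by omega⟩, by omega, hl⟩, ?_⟩, ?_⟩
        · simp only [List.sum_cons]
          omega
        · simp
          omega
  · rintro (⟨l, ⟨hl, hsum⟩, rfl⟩ | ⟨l, ⟨hl, hsum⟩, rfl⟩)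
    · refine ⟨⟨rfl, by decide, le_rfl, hl⟩, ?_⟩
      simp only [List.sum_cons]
      omega
    · match l, hl, hsum with
      | [], _, hsum => simp at hsum
      | [a], hl, hsum =>
        simp only [AlternatesOneOdd] at hl
        simp at hsum
        omega
      | a :: b :: l, ⟨ha, hodd, hb, hl⟩, hsum =>
        simp only [List.sum_cons] at hsum
        refine ⟨⟨ha, hodd.add_even even_two, Nat.le_add_right_of_le hb, hl⟩, ?_⟩
        simp
        omega

theorem modify_one_add_two_injective :
    Function.Injective (fun l : List ℕ => l.modify 1 (· + 2)) := by
  intro l m h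
  rcases l with _ | ⟨a, _ | ⟨b, l⟩⟩ <;> rcases m with _ | ⟨c, _ | ⟨d, m⟩⟩ <;> simp_all

theorem encard_alternatingCompositions_add_four (n : ℕ) :
    (alternatingCompositions (n + 4)).encard =
      (alternatingCompositions n).encard + (alternatingCompositions (n + 2)).encard := by
  rw [alternatingCompositions_add_four, Set.encard_union_eq, Function.Injective.encard_image,
    modify_one_add_two_injective.encard_image]
  · intro l m h
    simpa using h
  · rw [Set.disjoint_left]
    rintro _ ⟨l, -, rfl⟩ ⟨m, ⟨hm, -⟩, h⟩
    match m, hm, h with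
    | [], _, h => simp at h
    | [a], _, h => simp at h
    | a :: b :: m, ⟨_, _, hb, _⟩, h =>
      simp at h
      omega

theorem alternatingCompositions_zero : alternatingCompositions 0 = {[]} := by
  ext l
  match l with
  | [] => simp [alternatingCompositions, AlternatesOneOdd]
  | [a] => simp [alternatingCompositions, AlternatesOneOdd]; omega
  | a :: b :: l => simp [alternatingCompositions, AlternatesOneOdd]; omega

theorem alternatingCompositions_one : alternatingCompositions 1 = {[1]} := by
  ext l
  match l with
  | [] => simp [alternatingCompositions, AlternatesOneOdd]
  | [a] => simp [alternatingCompositions, AlternatesOneOdd]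
  | a :: b :: l => simp [alternatingCompositions, AlternatesOneOdd]; omega

theorem alternatingCompositions_eq_empty {n : ℕ} (h₁ : 1 < n) (h₄ : n < 4) :
    alternatingCompositions n = ∅ := by
  rw [Set.eq_empty_iff_forall_notMem]
  rintro l ⟨hl, hsum⟩
  match l, hl, hsum with
  | [], _, hsum => simp at hsum; omega
  | [a], hl, hsum =>
    simp only [AlternatesOneOdd] at hl
    simp at hsum
    omega
  | a :: b :: l, ⟨ha, _, hb, _⟩, hsum =>
    simp only [List.sum_cons] at hsum
    omega

theorem encard_alternatingCompositions (r : ℕ) (hr : r < 2) :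
    ∀ k : ℕ, (alternatingCompositions (2 * k + 2 + r)).encard = Nat.fib k
  | 0 => by simp [alternatingCompositions_eq_empty (n := 2 * 0 + 2 + r) (by omega) (by omega)]
  | 1 => by
    rw [show 2 * 1 + 2 + r = r + 4 by ring, encard_alternatingCompositions_add_four,
      alternatingCompositions_eq_empty (n := r + 2) (by omega) (by omega)]
    interval_cases r
    · simp [alternatingCompositions_zero]
    · simp [alternatingCompositions_one]
  | k + 2 => by
    rw [show 2 * (k + 2) + 2 + r = 2 * k + 2 + r + 4 by ring,
      encard_alternatingCompositions_add_four, encard_alternatingCompositions r hr k,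
      show 2 * k + 2 + r + 2 = 2 * (k + 1) + 2 + r by ring,
      encard_alternatingCompositions r hr (k + 1), Nat.fib_add_two]
    push_cast
    rfl

/-- `cV n` is the number of compositions of `n` whose parts in odd positions
(1-based) all equal `1` and whose parts in even positions (1-based) are all
odd and at least `3`.  For `j ≥ 1`, `cV (2j) = cV (2j+1) = fib (j-1)`. -/
theorem cV_eq_fib (cV : ℕ → ℕ)
    (hcV : ∀ n : ℕ, cV n = Nat.card {l : List ℕ // IsComposition n l ∧
      (∀ i : ℕ, 2 * i < l.length → l.getD (2 * i) 0 = 1) ∧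
      (∀ i : ℕ, 2 * i + 1 < l.length →
        Odd (l.getD (2 * i + 1) 0) ∧ 3 ≤ l.getD (2 * i + 1) 0)}) :
    ∀ j : ℕ, 1 ≤ j → cV (2 * j) = Nat.fib (j - 1) ∧ cV (2 * j + 1) = Nat.fib (j - 1) := by
  have key (n : ℕ) : cV n = (alternatingCompositions n).ncard := by
    rw [hcV, ← Nat.card_coe_set_eq]
    refine Nat.card_congr (Equiv.subtypeEquivRight fun l => ?_)
    rw [← alternatesOneOdd_iff_getD]
    exact ⟨fun h => ⟨h.2, h.1.2⟩, fun h => ⟨⟨h.1.pos, h.2⟩, h.1⟩⟩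
  intro j hj
  obtain ⟨k, rfl⟩ := Nat.exists_eq_add_of_le' hj
  have h₀ := encard_alternatingCompositions 0 (by omega) k
  have h₁ := encard_alternatingCompositions 1 (by omega) k
  rw [key, key, Set.ncard, Set.ncard, Nat.add_sub_cancel]
  exact ⟨congrArg ENat.toNat h₀, congrArg ENat.toNat h₁⟩
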